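/- There exists α₀>0 such that for every fixed α∈(0,α₀), with probability tending to 1 as n → ∞, a random graph G ~ G(n,1/2) has the following property: for every bisection A∪B of G and every pair of subsets A′⊆A and B′⊆B each of size ⌊αn⌋, we have |Δ_{A′,B′}| ≤ α^{4/3} n^{3/2}, where A′∪B′ is viewed as a bisection of the induced subgraph G[A′∪B′]. -/

import Mathlib

open Finset Filter

open scoped Classical

/-- The number of neighbours of `v` (in the graph `G`) lying in the set `S`. -/
noncomputable def degIn {n : ℕ} (G : SimpleGraph (Fin n)) (S : Finset (Fin n)) (v : Fin n) : ℕ :=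
  (S.filter fun w => G.Adj v w).card

/-- The friendliness of a vertex `v` with respect to the bisection `A ∪ Aᶜ`:
the number of neighbours in its own part minus the number of neighbours across. -/
noncomputable def friendliness {n : ℕ} (G : SimpleGraph (Fin n)) (A : Finset (Fin n))
    (v : Fin n) : ℤ :=
  if v ∈ A then (degIn G A v : ℤ) - (degIn G Aᶜ v : ℤ)
  else (degIn G Aᶜ v : ℤ) - (degIn G A v : ℤ)

/-- `A ∪ Aᶜ` is a bisection: the parts' sizes differ by at most one. -/
def IsBisection {n : ℕ} (A : Finset (Fin n)) : Prop :=
  |(A.card : ℤ) - (Aᶜ.card : ℤ)| ≤ 1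

/-- The probability, under the uniform measure on simple graphs on `Fin n`
(i.e. the Erdős–Rényi measure `G(n,1/2)`), of the set of graphs satisfying `P`. -/
noncomputable def graphProb (n : ℕ) (P : SimpleGraph (Fin n) → Prop) : ℝ :=
  ((univ.filter P).card : ℝ) / (Fintype.card (SimpleGraph (Fin n)) : ℝ)

/-- The total friendliness of the bisection `A' ∪ B'` of the induced subgraph `G[A' ∪ B']`:
for `v ∈ A'` the friendliness in the induced subgraph is `|N(v) ∩ A'| - |N(v) ∩ B'|`,
and symmetrically for `v ∈ B'`. -/
noncomputable def pairTotalFriendliness {n : ℕ} (G : SimpleGraph (Fin n))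
    (A' B' : Finset (Fin n)) : ℤ :=
  (∑ v ∈ A', ((degIn G A' v : ℤ) - (degIn G B' v : ℤ))) +
    (∑ v ∈ B', ((degIn G B' v : ℤ) - (degIn G A' v : ℤ)))

/-- The pairs `i < j` of vertices, indexing the potential edges of a graph on `Fin n`. -/
abbrev EdgeIndex (n : ℕ) : Type := {p : Fin n × Fin n // p.1 < p.2}

/-- A graph on `Fin n` amounts to a choice of a truth value for each pair `i < j`. -/
noncomputable def graphEquiv (n : ℕ) : SimpleGraph (Fin n) ≃ (EdgeIndex n → Bool) where
  toFun G e := decide (G.Adj e.1.1 e.1.2)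
  invFun f :=
    { Adj := fun i j => (∃ h : i < j, f ⟨(i, j), h⟩ = true) ∨ ∃ h : j < i, f ⟨(j, i), h⟩ = true
      symm := ⟨fun _ _ h => h.symm⟩
      loopless := ⟨fun i h => by simp at h⟩ }
  left_inv G := by
    ext i j
    rcases lt_trichotomy i j with h | h | h
    · simp [h, h.not_gt]
    · simp [h]
    · simp [h, h.not_gt, G.adj_comm]
  right_inv f := by
    ext ⟨⟨i, j⟩, h⟩
    have h' : i < j := h
    simp [h', h'.not_gt]

lemma sum_symm_eq {n : ℕ} (f : Fin n → Fin n → ℝ) (hf : ∀ i j, f i j = f j i) :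
    ∑ i, ∑ j, f i j = 2 * ∑ e : EdgeIndex n, f e.1.1 e.1.2 + ∑ i, f i i := by
  have hsub : ∑ e : EdgeIndex n, f e.1.1 e.1.2 = ∑ i, ∑ j, if i < j then f i j else 0 := by
    rw [← Fintype.sum_prod_type' (f := fun i j => if i < j then f i j else 0), ← sum_filter]
    exact (sum_subtype (univ.filter fun p : Fin n × Fin n => p.1 < p.2)
      (by simp) (fun p => f p.1 p.2)).symm
  have hswap : ∑ i, ∑ j, (if i < j then f i j else 0) = ∑ i, ∑ j, if j < i then f i j else 0 := by
    rw [sum_comm]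
    exact sum_congr rfl fun i _ => sum_congr rfl fun j _ => by rw [hf]
  have hdiag : ∑ i, f i i = ∑ i, ∑ j, if i = j then f i j else 0 := by simp
  rw [two_mul]
  nth_rewrite 2 [hsub]
  rw [hsub, hswap, hdiag, ← hswap]
  nth_rewrite 2 [hswap]
  simp only [← sum_add_distrib]
  refine sum_congr rfl fun i _ => sum_congr rfl fun j _ => ?_
  rcases lt_trichotomy i j with h | h | h
  · simp [h, h.not_gt, h.ne]
  · simp [h]
  · simp [h, h.not_gt, h.ne']

/-- The sign `+1` or `-1` recording whether `i` and `j` are adjacent. -/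
noncomputable def edgeSign {n : ℕ} (G : SimpleGraph (Fin n)) (i j : Fin n) : ℝ :=
  if G.Adj i j then 1 else -1

lemma sum_exp_edgeSign_le {n : ℕ} (c : EdgeIndex n → ℝ) :
    ∑ G : SimpleGraph (Fin n), Real.exp (∑ e, c e * edgeSign G e.1.1 e.1.2) ≤
      Fintype.card (SimpleGraph (Fin n)) * Real.exp ((∑ e, c e ^ 2) / 2) := by
  have hcard : (Fintype.card (SimpleGraph (Fin n)) : ℝ) = ∏ _e : EdgeIndex n, 2 := by
    rw [Fintype.card_congr (graphEquiv n)]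
    simp
  calc ∑ G : SimpleGraph (Fin n), Real.exp (∑ e, c e * edgeSign G e.1.1 e.1.2)
      = ∑ f : EdgeIndex n → Bool, ∏ e, Real.exp (c e * if f e = true then 1 else -1) := by
        refine Fintype.sum_equiv (graphEquiv n) _ _ fun G => ?_
        rw [Real.exp_sum]
        simp [graphEquiv, edgeSign]
    _ = ∏ e, ∑ b : Bool, Real.exp (c e * if b = true then 1 else -1) := by
        rw [prod_univ_sum, Fintype.piFinset_univ]
    _ = ∏ e, 2 * Real.cosh (c e) := by
        refine prod_congr rfl fun e _ => ?_
        rw [Real.cosh_eq]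
        simp
        ring
    _ ≤ ∏ e, 2 * Real.exp (c e ^ 2 / 2) := by
        refine prod_le_prod (fun e _ => by positivity) fun e _ => ?_
        gcongr
        exact Real.cosh_le_exp_half_sq _
    _ = _ := by rw [prod_mul_distrib, ← Real.exp_sum, hcard, sum_div]

lemma card_le_of_sum_exp_le {ι : Type*} [Fintype ι] (X : ι → ℝ) (t M : ℝ)
    (h : ∑ i, Real.exp (X i) ≤ M) :
    ((univ.filter fun i => t ≤ X i).card : ℝ) ≤ M * Real.exp (-t) := by
  rw [Real.exp_neg, ← div_eq_mul_inv, le_div_iff₀ (Real.exp_pos t)]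
  refine le_trans ?_ h
  calc ((univ.filter fun i => t ≤ X i).card : ℝ) * Real.exp t
      = ∑ _i ∈ univ.filter (fun i => t ≤ X i), Real.exp t := by simp
    _ ≤ ∑ i ∈ univ.filter (fun i => t ≤ X i), Real.exp (X i) :=
        sum_le_sum fun i hi => Real.exp_le_exp.2 (mem_filter.1 hi).2
    _ ≤ _ := sum_le_sum_of_subset_of_nonneg (filter_subset _ _) fun _ _ _ => (Real.exp_pos _).le

/-- Hoeffding's inequality for signed sums over the edges of a random graph. -/
lemma card_abs_edgeSign_sum_le {n : ℕ} (c : EdgeIndex n → ℝ) (V t l : ℝ)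
    (hV : ∑ e, c e ^ 2 ≤ V) (hl : 0 ≤ l) :
    ((univ.filter fun G : SimpleGraph (Fin n) =>
        t ≤ |∑ e, c e * edgeSign G e.1.1 e.1.2|).card : ℝ) ≤
      Fintype.card (SimpleGraph (Fin n)) * (2 * Real.exp (l ^ 2 * V / 2 - l * t)) := by
  have key : ∀ r : ℝ, r ^ 2 = l ^ 2 →
      ((univ.filter fun G : SimpleGraph (Fin n) =>
        l * t ≤ ∑ e, (r * c e) * edgeSign G e.1.1 e.1.2).card : ℝ) ≤
      Fintype.card (SimpleGraph (Fin n)) * Real.exp (l ^ 2 * V / 2 - l * t) := by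
    intro r hr
    have h := card_le_of_sum_exp_le _ (l * t) _ (sum_exp_edgeSign_le fun e => r * c e)
    refine h.trans ?_
    rw [mul_assoc, ← Real.exp_add]
    gcongr
    simp only [mul_pow, ← mul_sum, hr, sub_eq_add_neg]
    gcongr
  have hsub : (univ.filter fun G : SimpleGraph (Fin n) =>
        t ≤ |∑ e, c e * edgeSign G e.1.1 e.1.2|) ⊆
      (univ.filter fun G => l * t ≤ ∑ e, (l * c e) * edgeSign G e.1.1 e.1.2) ∪
      (univ.filter fun G => l * t ≤ ∑ e, (-l * c e) * edgeSign G e.1.1 e.1.2) := by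
    intro G hG
    simp only [mem_filter, mem_univ, true_and, mem_union, mul_assoc, ← mul_sum] at hG ⊢
    rcases le_abs.1 hG with h | h
    · exact Or.inl (mul_le_mul_of_nonneg_left h hl)
    · right
      have := mul_le_mul_of_nonneg_left h hl
      linarith
  have h1 := key l rfl
  have h2 := key (-l) (by ring)
  have h3 : ((univ.filter fun G : SimpleGraph (Fin n) =>
        t ≤ |∑ e, c e * edgeSign G e.1.1 e.1.2|).card : ℝ) ≤ _ :=
    Nat.cast_le.2 ((card_le_card hsub).trans (card_union_le _ _))
  push_cast at h3
  linarith

/-- The sign of a vertex with respect to the pair `A`, `B`: `1` on `A`, `-1` on `B`. -/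
noncomputable def pairSign {n : ℕ} (A B : Finset (Fin n)) (v : Fin n) : ℝ :=
  (if v ∈ A then 1 else 0) - if v ∈ B then 1 else 0

lemma sum_pairSign {n : ℕ} (A B : Finset (Fin n)) :
    ∑ v, pairSign A B v = A.card - B.card := by
  simp [pairSign]

lemma sum_pairSign_sq {n : ℕ} {A B : Finset (Fin n)} (h : Disjoint A B) :
    ∑ v, pairSign A B v ^ 2 = A.card + B.card := by
  have : ∀ v, pairSign A B v ^ 2 = (if v ∈ A then 1 else 0) + if v ∈ B then 1 else 0 := by
    intro v
    have : v ∈ A → v ∉ B := fun hv => disjoint_left.1 h hv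
    by_cases hA : v ∈ A <;> by_cases hB : v ∈ B <;> simp_all [pairSign]
  simp [this, sum_add_distrib]

lemma pairTotalFriendliness_eq_sum {n : ℕ} (G : SimpleGraph (Fin n)) (A B : Finset (Fin n)) :
    (pairTotalFriendliness G A B : ℝ) =
      ∑ v, ∑ w, pairSign A B v * pairSign A B w * if G.Adj v w then 1 else 0 := by
  have hdeg : ∀ v, ∑ w, pairSign A B w * (if G.Adj v w then 1 else 0) =
      (degIn G A v : ℝ) - degIn G B v := by
    intro v
    have hcard : ∀ S : Finset (Fin n),
        (degIn G S v : ℝ) = ∑ w, (if w ∈ S then 1 else 0) * if G.Adj v w then 1 else 0 := by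
      intro S
      simp only [ite_mul, one_mul, zero_mul, sum_ite_mem, univ_inter, sum_boole, degIn]
    simp only [pairSign, sub_mul, sum_sub_distrib, hcard]
  simp only [mul_assoc, ← mul_sum, hdeg]
  simp only [pairSign, sub_mul, sum_sub_distrib, ite_mul, one_mul, zero_mul, sum_ite_mem,
    univ_inter]
  simp only [pairTotalFriendliness]
  push_cast
  simp only [sum_sub_distrib]
  ring

lemma pairTotalFriendliness_eq_sub {n k : ℕ} (G : SimpleGraph (Fin n)) {A B : Finset (Fin n)}
    (h : Disjoint A B) (hA : A.card = k) (hB : B.card = k) :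
    (pairTotalFriendliness G A B : ℝ) =
      ∑ e : EdgeIndex n, pairSign A B e.1.1 * pairSign A B e.1.2 * edgeSign G e.1.1 e.1.2 - k := by
  rw [pairTotalFriendliness_eq_sum, sum_symm_eq _ fun i j => by
    rw [G.adj_comm, mul_comm (pairSign A B i)]]
  have h1 := sum_symm_eq (fun i j => pairSign A B i * pairSign A B j) fun i j => mul_comm _ _
  simp only [← mul_sum, ← sum_mul, sum_pairSign, ← sq, sum_pairSign_sq h, hA, hB, sub_self] at h1
  have h2 : ∑ e : EdgeIndex n, pairSign A B e.1.1 * pairSign A B e.1.2 * edgeSign G e.1.1 e.1.2 =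
      2 * ∑ e : EdgeIndex n, pairSign A B e.1.1 * pairSign A B e.1.2 *
        (if G.Adj e.1.1 e.1.2 then 1 else 0) -
      ∑ e : EdgeIndex n, pairSign A B e.1.1 * pairSign A B e.1.2 := by
    rw [mul_sum, ← sum_sub_distrib]
    refine sum_congr rfl fun e _ => ?_
    unfold edgeSign
    split_ifs <;> ring
  rw [h2]
  simp
  linarith

lemma sum_pairSign_mul_sq_le {n k : ℕ} {A B : Finset (Fin n)}
    (h : Disjoint A B) (hA : A.card = k) (hB : B.card = k) :
    ∑ e : EdgeIndex n, (pairSign A B e.1.1 * pairSign A B e.1.2) ^ 2 ≤ 2 * (k : ℝ) ^ 2 := by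
  have h1 := sum_symm_eq (fun i j => (pairSign A B i * pairSign A B j) ^ 2)
    fun i j => by rw [mul_comm]
  have h2 : 0 ≤ ∑ i, (pairSign A B i * pairSign A B i) ^ 2 := sum_nonneg fun _ _ => sq_nonneg _
  have h3 : ∑ i, ∑ j, (pairSign A B i * pairSign A B j) ^ 2 = (k + k : ℝ) * (k + k) := by
    simp only [mul_pow, ← mul_sum, ← sum_mul, sum_pairSign_sq h, hA, hB]
  linarith

/-- Some disjoint pair of `k`-sets has total friendliness exceeding `T` in absolute value. -/
def HasLargePair {n : ℕ} (k : ℕ) (T : ℝ) (G : SimpleGraph (Fin n)) : Prop :=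
  ∃ A B : Finset (Fin n), Disjoint A B ∧ A.card = k ∧ B.card = k ∧
    T < |(pairTotalFriendliness G A B : ℝ)|

/-- A union bound over all disjoint pairs of `k`-sets for the number of graphs with a large pair. -/
lemma card_exists_lt_abs_le {n k : ℕ} (T l : ℝ) (hl : 0 ≤ l) :
    ((univ.filter fun G : SimpleGraph (Fin n) => HasLargePair k T G).card : ℝ) ≤
      (n.choose k : ℝ) ^ 2 * (Fintype.card (SimpleGraph (Fin n)) *
        (2 * Real.exp (l ^ 2 * (k : ℝ) ^ 2 - l * (T - k)))) := by
  set P := (powersetCard k (univ : Finset (Fin n)) ×ˢ powersetCard k univ).filter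
    (fun p => Disjoint p.1 p.2) with hP
  set F : Finset (Fin n) × Finset (Fin n) → Finset (SimpleGraph (Fin n)) := fun p =>
    univ.filter fun G => T - k ≤
      |∑ e : EdgeIndex n, pairSign p.1 p.2 e.1.1 * pairSign p.1 p.2 e.1.2 *
        edgeSign G e.1.1 e.1.2| with hF
  have hsub : (univ.filter fun G : SimpleGraph (Fin n) => HasLargePair k T G) ⊆ P.biUnion F := by
    intro G hG
    obtain ⟨A, B, hd, hA, hB, h⟩ := (mem_filter.1 hG).2
    rw [pairTotalFriendliness_eq_sub G hd hA hB] at h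
    refine mem_biUnion.2 ⟨(A, B), by simp [hP, hd, hA, hB], ?_⟩
    simp only [hF, mem_filter, mem_univ, true_and]
    have h1 := h.trans_le (abs_sub _ _)
    rw [Nat.abs_cast] at h1
    linarith
  have hle : ∀ p ∈ P, ((F p).card : ℝ) ≤ Fintype.card (SimpleGraph (Fin n)) *
        (2 * Real.exp (l ^ 2 * (k : ℝ) ^ 2 - l * (T - k))) := by
    intro p hp
    simp only [hP, mem_filter, mem_product, mem_powersetCard_univ] at hp
    have := card_abs_edgeSign_sum_le _ _ (T - k) l
      (sum_pairSign_mul_sq_le hp.2 hp.1.1 hp.1.2) hl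
    rwa [show l ^ 2 * (2 * (k : ℝ) ^ 2) / 2 = l ^ 2 * (k : ℝ) ^ 2 by ring] at this
  have hPcard : (P.card : ℝ) ≤ (n.choose k : ℝ) ^ 2 := by
    have : P.card ≤ n.choose k ^ 2 := by
      refine (card_filter_le _ _).trans ?_
      simp [card_product, sq]
    exact_mod_cast this
  calc _ ≤ ((P.biUnion F).card : ℝ) := by exact_mod_cast card_le_card hsub
    _ ≤ ∑ p ∈ P, ((F p).card : ℝ) := by exact_mod_cast card_biUnion_le
    _ ≤ _ := sum_le_card_nsmul _ _ _ hle
    _ ≤ _ := by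
      rw [nsmul_eq_mul]
      gcongr

lemma choose_floor_le_exp {s : ℝ} (hs : 0 < s) (hs1 : s ≤ 1) (n : ℕ) :
    (n.choose ⌊s ^ 6 * n⌋₊ : ℝ) ≤ Real.exp (6 * s ^ 5 * n) := by
  set k := ⌊s ^ 6 * n⌋₊
  have hk : (k : ℝ) ≤ s ^ 6 * n := Nat.floor_le (by positivity)
  rcases lt_or_ge n k with hlt | hkn
  · rw [Nat.choose_eq_zero_of_lt hlt]
    simpa using (Real.exp_pos _).le
  have h1 : (n.choose k : ℝ) * (s ^ 6) ^ k ≤ Real.exp (s ^ 6 * n) := by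
    calc (n.choose k : ℝ) * (s ^ 6) ^ k
        = (s ^ 6) ^ k * 1 ^ (n - k) * n.choose k := by ring
      _ ≤ ∑ m ∈ range (n + 1), (s ^ 6) ^ m * 1 ^ (n - m) * n.choose m :=
          single_le_sum (f := fun m => (s ^ 6) ^ m * 1 ^ (n - m) * (n.choose m : ℝ))
            (fun _ _ => by positivity) (mem_range.2 (by omega))
      _ = (s ^ 6 + 1) ^ n := (add_pow _ _ _).symm
      _ ≤ Real.exp (s ^ 6) ^ n := by
          gcongr
          exact Real.add_one_le_exp _
      _ = _ := by rw [← Real.exp_nat_mul, mul_comm]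
  have h2 : Real.exp (-(6 * (1 / s - 1) * (s ^ 6 * n))) ≤ (s ^ 6) ^ k := by
    have hlog : -Real.log s ≤ 1 / s - 1 := by
      rw [← Real.log_inv, one_div]
      exact Real.log_le_sub_one_of_pos (by positivity)
    have hlog0 : 0 ≤ -Real.log s := neg_nonneg.2 (Real.log_nonpos hs.le hs1)
    rw [← Real.exp_log (pow_pos (pow_pos hs 6) k)]
    refine Real.exp_le_exp.2 ?_
    rw [Real.log_pow, Real.log_pow]
    push_cast
    have := mul_le_mul hlog hk (by positivity) (hlog0.trans hlog)
    nlinarith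
  have h3 : (n.choose k : ℝ) * Real.exp (-(6 * (1 / s - 1) * (s ^ 6 * n))) ≤
      Real.exp (s ^ 6 * n) := le_trans (by gcongr) h1
  rw [Real.exp_neg, ← div_eq_mul_inv, div_le_iff₀ (Real.exp_pos _), ← Real.exp_add] at h3
  refine h3.trans (Real.exp_le_exp.2 ?_)
  have h4 : s ^ 6 * n + 6 * (1 / s - 1) * (s ^ 6 * n) = 6 * s ^ 5 * n - 5 * (s ^ 6 * n) := by
    field_simp
    ring
  have : 0 ≤ s ^ 6 * (n : ℝ) := by positivity
  linarith

lemma graphProb_le_one {n : ℕ} (P : SimpleGraph (Fin n) → Prop) : graphProb n P ≤ 1 := by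
  refine div_le_one_of_le₀ ?_ (by positivity)
  exact_mod_cast card_le_univ _

lemma one_sub_le_graphProb {n : ℕ} (P Q : SimpleGraph (Fin n) → Prop) (b : ℝ)
    (hPQ : ∀ G, ¬ P G → Q G)
    (h : ((univ.filter Q).card : ℝ) ≤ b * Fintype.card (SimpleGraph (Fin n))) :
    1 - b ≤ graphProb n P := by
  have hpos : (0 : ℝ) < Fintype.card (SimpleGraph (Fin n)) := by
    exact_mod_cast Fintype.card_pos
  rw [graphProb, le_div_iff₀ hpos]
  have hcard : Fintype.card (SimpleGraph (Fin n)) ≤ (univ.filter P).card + (univ.filter Q).card := by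
    rw [← card_univ, ← card_filter_add_card_filter_not (s := univ) P]
    exact Nat.add_le_add_left (card_le_card (monotone_filter_right _ fun G _ => hPQ G)) _
  have : (Fintype.card (SimpleGraph (Fin n)) : ℝ) ≤
    (univ.filter P).card + (univ.filter Q).card := by exact_mod_cast hcard
  linarith

/-- there is `α₀ > 0` such that for every fixed `α ∈ (0,α₀)`, with high
probability, for every bisection `A ∪ Aᶜ` of `G(n,1/2)` and all `A' ⊆ A`, `B' ⊆ Aᶜ` of size
`⌊αn⌋`, viewing `A' ∪ B'` as a bisection of `G[A' ∪ B']` we have `|Δ_{A',B'}| ≤ α^{4/3} n^{3/2}`. -/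
theorem statement5 :
    ∃ α₀ : ℝ, 0 < α₀ ∧ ∀ α : ℝ, 0 < α → α < α₀ →
      Tendsto (fun n : ℕ => graphProb n (fun G => ∀ A : Finset (Fin n), IsBisection A →
          ∀ A' B' : Finset (Fin n), A' ⊆ A → B' ⊆ Aᶜ →
            A'.card = ⌊α * n⌋₊ → B'.card = ⌊α * n⌋₊ →
            |(pairTotalFriendliness G A' B' : ℝ)| ≤ α ^ (4 / 3 : ℝ) * (n : ℝ) ^ (3 / 2 : ℝ)))
        atTop (nhds 1) := by
  refine ⟨(1 / 200) ^ 6, by positivity, fun α hα hα₀ => ?_⟩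
  obtain ⟨s, hs, rfl⟩ : ∃ s : ℝ, 0 < s ∧ s ^ 6 = α :=
    ⟨α ^ (1 / 6 : ℝ), by positivity, by rw [← Real.rpow_natCast, ← Real.rpow_mul hα.le]; norm_num⟩
  have hs' : s < 1 / 200 := lt_of_pow_lt_pow_left₀ 6 (by norm_num) hα₀
  have hpow : (s ^ 6) ^ (4 / 3 : ℝ) = s ^ 8 := by
    rw [← Real.rpow_natCast, ← Real.rpow_mul hs.le, ← Real.rpow_natCast]
    norm_num
  set d : ℝ := s ^ 4 * (1 / 16 - 12 * s) with hd
  have hdpos : 0 < d := mul_pos (by positivity) (by linarith)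
  have hlim : Tendsto (fun n : ℕ => 1 - 2 * Real.exp (-(d * n))) atTop (nhds 1) := by
    have h1 : Tendsto (fun n : ℕ => Real.exp (-(d * n))) atTop (nhds 0) :=
      Real.tendsto_exp_neg_atTop_nhds_zero.comp
        (tendsto_natCast_atTop_atTop.const_mul_atTop hdpos)
    simpa using (h1.const_mul 2).const_sub 1
  refine tendsto_of_tendsto_of_tendsto_of_le_of_le' hlim tendsto_const_nhds ?_
    (Eventually.of_forall fun n => graphProb_le_one _)
  filter_upwards [(tendsto_natCast_atTop_atTop (R := ℝ)).eventually_ge_atTop (4 / s ^ 4)] with n hn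
  have hn0 : (0 : ℝ) < n := lt_of_lt_of_le (by positivity) hn
  set r : ℝ := √n with hr
  have hr0 : 0 < r := Real.sqrt_pos.2 hn0
  have hrn : r ^ 2 = n := Real.sq_sqrt hn0.le
  have hnpow : (n : ℝ) ^ (3 / 2 : ℝ) = r ^ 3 := by
    rw [← hrn, ← Real.rpow_natCast, ← Real.rpow_mul hr0.le, ← Real.rpow_natCast]
    norm_num
  rw [hpow, hnpow]
  set k := ⌊s ^ 6 * n⌋₊ with hk
  have hkle : (k : ℝ) ≤ s ^ 6 * r ^ 2 := by rw [hrn]; exact Nat.floor_le (by positivity)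
  have hrs : 2 ≤ s ^ 2 * r := by
    have : 2 ^ 2 ≤ (s ^ 2 * r) ^ 2 := by
      rw [div_le_iff₀ (by positivity)] at hn
      calc (2 : ℝ) ^ 2 = 4 := by norm_num
        _ ≤ n * s ^ 4 := hn
        _ = _ := by rw [← hrn]; ring
    exact le_of_sq_le_sq this (by positivity)
  have hkT : (k : ℝ) ≤ s ^ 8 * r ^ 3 / 2 := by
    have := mul_le_mul_of_nonneg_left hrs (show 0 ≤ s ^ 6 * r ^ 2 by positivity)
    nlinarith
  refine one_sub_le_graphProb _ (HasLargePair k (s ^ 8 * r ^ 3)) _ ?_ ?_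
  · intro G hG
    push Not at hG
    obtain ⟨A, -, A', B', hA', hB', hcA, hcB, hlt⟩ := hG
    exact ⟨A', B', disjoint_compl_right.mono hA' hB', hcA, hcB, hlt⟩
  set l : ℝ := 1 / (4 * s ^ 4 * r) with hl
  have hl0 : 0 < l := by positivity
  have hexp : l ^ 2 * (k : ℝ) ^ 2 - l * (s ^ 8 * r ^ 3 - k) ≤ -(s ^ 4 * n / 16) := by
    have h1 : l ^ 2 * (k : ℝ) ^ 2 ≤ l ^ 2 * (s ^ 6 * r ^ 2) ^ 2 := by gcongr
    have h2 : l * (s ^ 8 * r ^ 3 / 2) ≤ l * (s ^ 8 * r ^ 3 - k) := by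
      gcongr
      linarith
    have h3 : l ^ 2 * (s ^ 6 * r ^ 2) ^ 2 - l * (s ^ 8 * r ^ 3 / 2) = -(s ^ 4 * n / 16) := by
      rw [hl, ← hrn]
      field_simp
      ring
    linarith
  refine (card_exists_lt_abs_le (s ^ 8 * r ^ 3) l hl0.le).trans ?_
  have hchoose := choose_floor_le_exp hs (by linarith) n
  calc (n.choose k : ℝ) ^ 2 * (Fintype.card (SimpleGraph (Fin n)) *
        (2 * Real.exp (l ^ 2 * (k : ℝ) ^ 2 - l * (s ^ 8 * r ^ 3 - k))))
      ≤ Real.exp (6 * s ^ 5 * n) ^ 2 * (Fintype.card (SimpleGraph (Fin n)) *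
        (2 * Real.exp (-(s ^ 4 * n / 16)))) := by gcongr
    _ = 2 * (Real.exp (6 * s ^ 5 * n) ^ 2 * Real.exp (-(s ^ 4 * n / 16))) *
        Fintype.card (SimpleGraph (Fin n)) := by ring
    _ = _ := by
      rw [← Real.exp_nat_mul, ← Real.exp_add]
      congr 3
      rw [hd]
      push_cast
      ring
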